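/- arXiv:2502.01032 — 3 statements merged into one kernel-verified Lean document; each statement's English description precedes it below -/
import Mathlib

section
/- Let X_1, …, X_n be jointly Gaussian random variables, i.e. X_i = μ_i + Σ_{j=1}^m A_{ij} ζ_j for a matrix A ∈ ℝ^{n×m}, means μ_i ∈ ℝ, and i.i.d. standard Gaussian variables ζ_1, …, ζ_m. Then E[X_1 X_2 ⋯ X_n] = Σ_{(S,P)} (∏_{s ∈ S} μ_s) (∏_{{i,j} ∈ P} Cov(X_i, X_j)), where the sum ranges over all partitions of {1, …, n} into a set S of singletons and a set P of unordered pairs, and Cov(X_i, X_j) = (A Aᵀ)_{ij}. -/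
open MeasureTheory ProbabilityTheory Matrix

lemma integrable_pow_gaussianReal (μ : ℝ) (v : NNReal) (k : ℕ) :
    Integrable (fun x : ℝ => x ^ k) (gaussianReal μ v) := by
  have h := (memLp_id_gaussianReal (μ := μ) (v := v) (k : NNReal)).integrable_norm_pow' (p := k)
  rw [← integrable_norm_iff (by fun_prop)]
  simpa using h

lemma hasDerivAt_gaussianPDFReal_zero_one (x : ℝ) :
    HasDerivAt (gaussianPDFReal 0 1) (-x * gaussianPDFReal 0 1 x) x := by
  have h : HasDerivAt (fun y : ℝ => -(y - 0) ^ 2 / (2 * ((1 : NNReal) : ℝ))) (-x) x := by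
    have := (((hasDerivAt_id x).sub_const 0).pow 2).neg.div_const (2 * ((1 : NNReal) : ℝ))
    refine this.congr_deriv ?_
    simp
    ring
  refine (h.exp.const_mul (√(2 * Real.pi * ((1 : NNReal) : ℝ)))⁻¹).congr_deriv ?_
  rw [gaussianPDFReal]
  ring

lemma integral_pow_succ_gaussianReal_zero_one (k : ℕ) :
    ∫ x, x ^ (k + 1) ∂gaussianReal 0 1 = k * ∫ x, x ^ (k - 1) ∂gaussianReal 0 1 := by
  have hint (j : ℕ) : Integrable (fun x : ℝ => gaussianPDFReal 0 1 x * x ^ j) := by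
    have h := integrable_pow_gaussianReal 0 1 j
    rw [gaussianReal_of_var_ne_zero _ one_ne_zero, integrable_withDensity_iff_integrable_smul'
      (measurable_gaussianPDF _ _) (ae_of_all _ fun _ => gaussianPDF_lt_top)] at h
    simpa using h
  have key := integral_mul_deriv_eq_deriv_mul_of_integrable (u := fun x : ℝ => x ^ k)
    (u' := fun x => k * x ^ (k - 1)) (v := gaussianPDFReal 0 1)
    (v' := fun x => -x * gaussianPDFReal 0 1 x)
    (fun x _ => hasDerivAt_pow k x) (fun x _ => hasDerivAt_gaussianPDFReal_zero_one x)
    (((hint (k + 1)).neg).congr (ae_of_all _ fun x => by simp; ring))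
    (((hint (k - 1)).const_mul (k : ℝ)).congr (ae_of_all _ fun x => by simp; ring))
    ((hint k).congr (ae_of_all _ fun x => by simp; ring))
  simp only [integral_gaussianReal_eq_integral_smul (one_ne_zero (α := NNReal)), smul_eq_mul]
  rw [← integral_const_mul, ← neg_inj, ← integral_neg]
  refine (Eq.trans ?_ key).trans (congrArg Neg.neg ?_)
  · exact integral_congr_ae (ae_of_all _ fun x => by simp only; ring)
  · exact integral_congr_ae (ae_of_all _ fun x => by simp only; ring)

section
variable {κ : Type*} [Fintype κ]

lemma integrable_eval_pi_gaussianReal (p : MvPolynomial κ ℝ) :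
    Integrable (fun ω => MvPolynomial.eval ω p) (Measure.pi fun _ : κ => gaussianReal 0 1) := by
  induction p using MvPolynomial.induction_on' with
  | monomial s c =>
    simp only [MvPolynomial.eval_monomial, Finsupp.prod_pow]
    exact (Integrable.fintype_prod fun j => integrable_pow_gaussianReal 0 1 (s j)).const_mul c
  | add p q hp hq =>
    simp only [map_add]
    exact hp.add hq

/-- **Gaussian integration by parts** for polynomials. -/
lemma integral_eval_X_mul_pi_gaussianReal (j : κ) (p : MvPolynomial κ ℝ) :
    ∫ ω, MvPolynomial.eval ω (MvPolynomial.X j * p) ∂(Measure.pi fun _ : κ => gaussianReal 0 1) =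
      ∫ ω, MvPolynomial.eval ω (MvPolynomial.pderiv j p)
        ∂(Measure.pi fun _ : κ => gaussianReal 0 1) := by
  classical
  induction p using MvPolynomial.induction_on' with
  | monomial s c =>
    rw [MvPolynomial.pderiv_monomial, MvPolynomial.X, MvPolynomial.monomial_mul]
    simp only [MvPolynomial.eval_monomial, Finsupp.prod_pow, integral_const_mul]
    rw [integral_fintype_prod_eq_prod
        (f := fun i (x : ℝ) => x ^ (Finsupp.single j 1 + s : κ →₀ ℕ) i),
      integral_fintype_prod_eq_prod (f := fun i (x : ℝ) => x ^ (s - Finsupp.single j 1 : κ →₀ ℕ) i),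
      ← Finset.mul_prod_erase _ _ (Finset.mem_univ j),
      ← Finset.mul_prod_erase _ _ (Finset.mem_univ j)]
    have h : ∀ i ∈ Finset.univ.erase j,
        ∫ x, x ^ (Finsupp.single j 1 + s : κ →₀ ℕ) i ∂gaussianReal 0 1 =
          ∫ x, x ^ (s - Finsupp.single j 1 : κ →₀ ℕ) i ∂gaussianReal 0 1 := fun i hi => by
      simp [Finsupp.single_eq_of_ne (Finset.ne_of_mem_erase hi)]
    rw [Finset.prod_congr rfl h]
    have := integral_pow_succ_gaussianReal_zero_one (s j)
    simp only [Finsupp.add_apply, Finsupp.single_eq_same, Finsupp.tsub_apply, add_comm 1 (s j),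
      this]
    ring
  | add p q hp hq =>
    simp only [mul_add, map_add]
    rw [integral_add (integrable_eval_pi_gaussianReal _) (integrable_eval_pi_gaussianReal _),
      integral_add (integrable_eval_pi_gaussianReal _) (integrable_eval_pi_gaussianReal _), hp, hq]

lemma pderiv_prod_affine {ι : Type*} [DecidableEq ι] (μ : ι → ℝ) (A : Matrix ι κ ℝ) (j : κ)
    (T : Finset ι) :
    MvPolynomial.pderiv j (∏ i ∈ T, (MvPolynomial.C (μ i) +
        ∑ k, MvPolynomial.C (A i k) * MvPolynomial.X k)) =
      ∑ b ∈ T, MvPolynomial.C (A b j) * ∏ i ∈ T.erase b, (MvPolynomial.C (μ i) +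
        ∑ k, MvPolynomial.C (A i k) * MvPolynomial.X k) := by
  classical
  induction T using Finset.induction_on with
  | empty => simp
  | insert a T ha ih =>
    rw [Finset.prod_insert ha, MvPolynomial.pderiv_mul, ih, Finset.sum_insert ha,
      Finset.erase_insert ha]
    congr 1
    · congr 1
      simp [MvPolynomial.pderiv_X, Pi.single_apply]
    · rw [Finset.mul_sum]
      refine Finset.sum_congr rfl fun b hb => ?_
      have hab : a ≠ b := fun h => ha (h ▸ hb)
      rw [Finset.erase_insert_of_ne hab, Finset.prod_insert (by simp [ha])]
      ring

lemma integral_prod_affine_insert {ι : Type*} [DecidableEq ι] (μ : ι → ℝ) (A : Matrix ι κ ℝ)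
    {a : ι} {T : Finset ι} (ha : a ∉ T) :
    ∫ ω, ∏ i ∈ insert a T, (μ i + ∑ j, A i j * ω j)
        ∂(Measure.pi fun _ : κ => gaussianReal 0 1) =
      μ a * ∫ ω, ∏ i ∈ T, (μ i + ∑ j, A i j * ω j) ∂(Measure.pi fun _ : κ => gaussianReal 0 1) +
      ∑ b ∈ T, (A * Aᵀ) b a * ∫ ω, ∏ i ∈ T.erase b, (μ i + ∑ j, A i j * ω j)
        ∂(Measure.pi fun _ : κ => gaussianReal 0 1) := by
  set F : Finset ι → MvPolynomial κ ℝ := fun U => ∏ i ∈ U, (MvPolynomial.C (μ i) +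
        ∑ k, MvPolynomial.C (A i k) * MvPolynomial.X k) with hF
  have hev (U : Finset ι) (ω : κ → ℝ) :
      ∏ i ∈ U, (μ i + ∑ j, A i j * ω j) = MvPolynomial.eval ω (F U) := by
    simp [hF, map_prod]
  simp only [hev]
  have hsplit : F (insert a T) = MvPolynomial.C (μ a) * F T +
      ∑ j, MvPolynomial.C (A a j) * (MvPolynomial.X j * F T) := by
    simp only [hF, Finset.prod_insert ha, add_mul, Finset.sum_mul, mul_assoc]
  simp only [hsplit, map_add, map_sum, map_mul (MvPolynomial.eval _) (MvPolynomial.C _),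
    MvPolynomial.eval_C]
  rw [integral_add ((integrable_eval_pi_gaussianReal _).const_mul _)
    (integrable_finsetSum _ fun j _ => (integrable_eval_pi_gaussianReal _).const_mul _),
    integral_finsetSum _ fun j _ => (integrable_eval_pi_gaussianReal _).const_mul _]
  simp only [integral_const_mul, integral_eval_X_mul_pi_gaussianReal]
  have hpderiv (j : κ) : MvPolynomial.pderiv j (F T) =
      ∑ b ∈ T, MvPolynomial.C (A b j) * F (T.erase b) := pderiv_prod_affine μ A j T
  simp only [hpderiv, map_sum, map_mul (MvPolynomial.eval _) (MvPolynomial.C _),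
    MvPolynomial.eval_C]
  congr 1
  have hsum (j : κ) := integral_finsetSum (μ := Measure.pi fun _ : κ => gaussianReal 0 1) T
    fun b _ => (integrable_eval_pi_gaussianReal (F (T.erase b))).const_mul (A b j)
  simp only [hsum, integral_const_mul, Finset.mul_sum]
  rw [Finset.sum_comm]
  simp only [Matrix.mul_apply, Matrix.transpose_apply, Finset.sum_mul]
  exact Finset.sum_congr rfl fun b _ => Finset.sum_congr rfl fun j _ => by ring
end

/-- `S` and the members of the pairs in `Q` (each pair written in increasing order) partition
`T`. -/
def IsSingletonPairPartition {ι : Type*} [LT ι] (T S : Finset ι) (Q : Finset (ι × ι)) : Prop :=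
  (∀ p ∈ Q, p.1 < p.2) ∧ S.val + Q.val.bind (fun p => {p.1, p.2}) = T.val

namespace IsSingletonPairPartition
variable {ι : Type*} [LinearOrder ι] {T S : Finset ι} {Q : Finset (ι × ι)} {a b : ι}

lemma mem_of_mem_left (h : IsSingletonPairPartition T S Q) (ha : a ∈ S) : a ∈ T := by
  rw [← Finset.mem_val, ← h.2]
  exact Multiset.mem_add.2 (Or.inl ha)

lemma mem_of_mem_right {p : ι × ι} (h : IsSingletonPairPartition T S Q) (hp : p ∈ Q) :
    p.1 ∈ T ∧ p.2 ∈ T := by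
  simp only [← Finset.mem_val, ← h.2]
  exact ⟨Multiset.mem_add.2 (Or.inr (Multiset.mem_bind.2 ⟨p, hp, by simp⟩)),
    Multiset.mem_add.2 (Or.inr (Multiset.mem_bind.2 ⟨p, hp, by simp⟩))⟩

lemma insert_left_iff (haT : a ∉ T) (haS : a ∉ S) :
    IsSingletonPairPartition (insert a T) (insert a S) Q ↔ IsSingletonPairPartition T S Q := by
  simp only [IsSingletonPairPartition, Finset.insert_val_of_notMem haT,
    Finset.insert_val_of_notMem haS, Multiset.cons_add, Multiset.cons_inj_right]

lemma insert_right_iff (haT : a ∉ T) (hbT : b ∉ T) (hba : b < a) (hQ : (b, a) ∉ Q) :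
    IsSingletonPairPartition (insert a (insert b T)) S (insert (b, a) Q) ↔
      IsSingletonPairPartition T S Q := by
  have h : a ∉ insert b T := by simp [haT, hba.ne']
  simp only [IsSingletonPairPartition, Finset.insert_val_of_notMem h,
    Finset.insert_val_of_notMem hbT, Finset.insert_val_of_notMem hQ, Multiset.cons_bind,
    Finset.forall_mem_insert, hba, true_and]
  have : S.val + (({b, a} : Multiset ι) + Q.val.bind fun p => {p.1, p.2}) =
      a ::ₘ b ::ₘ (S.val + Q.val.bind fun p => {p.1, p.2}) := by
    rw [← Multiset.singleton_add a, ← Multiset.singleton_add b, Multiset.insert_eq_cons,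
      ← Multiset.singleton_add b]
    abel
  rw [this, Multiset.cons_inj_right, Multiset.cons_inj_right]

lemma erase_right (h : IsSingletonPairPartition (insert a T) S Q) (haT : a ∉ T)
    (hQ : (b, a) ∈ Q) : b ∈ T ∧ IsSingletonPairPartition (T.erase b) S (Q.erase (b, a)) := by
  have hba : b < a := h.1 _ hQ
  have hbT : b ∈ T := (Finset.mem_insert.1 (h.mem_of_mem_right hQ).1).resolve_left hba.ne
  refine ⟨hbT, (insert_right_iff (by simp [haT]) (by simp) hba (by simp)).1 ?_⟩
  rwa [Finset.insert_erase hbT, Finset.insert_erase hQ]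

lemma existsUnique_pair (h : IsSingletonPairPartition (insert a T) S Q)
    (ha : ∀ x ∈ T, x < a) (haS : a ∉ S) : ∃! b, (b, a) ∈ Q := by
  have haT : a ∉ T := fun h => (ha a h).false
  have hmem : a ∈ S.val + Q.val.bind (fun p => {p.1, p.2}) := by rw [h.2]; simp
  obtain ⟨⟨b, c⟩, hp, hap⟩ := Multiset.mem_bind.1 ((Multiset.mem_add.1 hmem).resolve_left haS)
  have hlt : b < c := h.1 _ hp
  obtain rfl : a = c := by
    simp only [Multiset.insert_eq_cons, Multiset.mem_cons, Multiset.mem_singleton] at hap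
    refine hap.resolve_left fun hab => ?_
    subst hab
    rcases Finset.mem_insert.1 (h.mem_of_mem_right hp).2 with hc | hc
    · exact hlt.ne' hc
    · exact (ha c hc).asymm hlt
  refine ⟨b, hp, fun b' hb' => ?_⟩
  by_contra hne
  have := ((h.erase_right haT hp).2.mem_of_mem_right
    (Finset.mem_erase.2 ⟨by simpa using hne, hb'⟩)).2
  exact haT (Finset.mem_of_mem_erase this)

end IsSingletonPairPartition

open Classical in
/-- The sum over partitions of `T` into singletons and pairs of the products of the weights `μ` of
the singletons and the weights `C` of the pairs. -/
noncomputable def singletonPairSum {ι : Type*} [Fintype ι] [LT ι] (μ : ι → ℝ)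
    (C : Matrix ι ι ℝ) (T : Finset ι) : ℝ :=
  ∑ x : Finset ι × Finset (ι × ι) with IsSingletonPairPartition T x.1 x.2,
    (∏ s ∈ x.1, μ s) * ∏ p ∈ x.2, C p.1 p.2

section
variable {ι : Type*} [Fintype ι] [LinearOrder ι] (μ : ι → ℝ) (C : Matrix ι ι ℝ)

lemma singletonPairSum_empty : singletonPairSum μ C ∅ = 1 := by
  classical
  have : (Finset.univ.filter fun x : Finset ι × Finset (ι × ι) =>
      IsSingletonPairPartition ∅ x.1 x.2) = {(∅, ∅)} := by
    ext ⟨S, Q⟩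
    simp only [Finset.mem_filter, Finset.mem_univ, true_and, Finset.mem_singleton, Prod.mk.injEq]
    refine ⟨fun h => ⟨?_, ?_⟩, ?_⟩
    · exact Finset.eq_empty_of_forall_notMem fun s hs => by simpa using h.mem_of_mem_left hs
    · exact Finset.eq_empty_of_forall_notMem fun p hp => by simpa using (h.mem_of_mem_right hp).1
    · rintro ⟨rfl, rfl⟩
      simp [IsSingletonPairPartition]
  rw [singletonPairSum, this]
  simp

lemma singletonPairSum_insert {a : ι} {T : Finset ι} (ha : ∀ x ∈ T, x < a) :
    singletonPairSum μ C (insert a T) = μ a * singletonPairSum μ C T +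
      ∑ b ∈ T, C b a * singletonPairSum μ C (T.erase b) := by
  classical
  have haT : a ∉ T := fun h => (ha a h).false
  rw [singletonPairSum, ← Finset.sum_filter_add_sum_filter_not _ (fun x => a ∈ x.1)]
  congr 1
  · rw [singletonPairSum, Finset.mul_sum]
    refine Finset.sum_nbij' (fun x => (x.1.erase a, x.2)) (fun x => (insert a x.1, x.2)) ?_ ?_ ?_
      ?_ ?_
    · rintro ⟨S, Q⟩ h
      simp only [Finset.mem_filter, Finset.mem_univ, true_and] at h ⊢
      rw [← IsSingletonPairPartition.insert_left_iff haT (Finset.notMem_erase a S),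
        Finset.insert_erase h.2]
      exact h.1
    · rintro ⟨S, Q⟩ h
      simp only [Finset.mem_filter, Finset.mem_univ, true_and] at h ⊢
      exact ⟨(IsSingletonPairPartition.insert_left_iff haT
        fun hS => haT (h.mem_of_mem_left hS)).2 h, Finset.mem_insert_self _ _⟩
    · rintro ⟨S, Q⟩ h
      simp only [Finset.mem_filter, Finset.mem_univ, true_and] at h ⊢
      rw [Finset.insert_erase h.2]
    · rintro ⟨S, Q⟩ h
      simp only [Finset.mem_filter, Finset.mem_univ, true_and] at h ⊢
      rw [Finset.erase_insert fun hS => haT (h.mem_of_mem_left hS)]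
    · rintro ⟨S, Q⟩ h
      simp only [Finset.mem_filter, Finset.mem_univ, true_and] at h ⊢
      rw [← Finset.mul_prod_erase _ _ h.2, mul_assoc]
  · have hpair : ∀ b ∈ T, C b a * singletonPairSum μ C (T.erase b) =
        ∑ x : Finset ι × Finset (ι × ι) with
          (IsSingletonPairPartition (insert a T) x.1 x.2 ∧ a ∉ x.1) ∧ (b, a) ∈ x.2,
          (∏ s ∈ x.1, μ s) * ∏ p ∈ x.2, C p.1 p.2 := by
      intro b hb
      have haTb : a ∉ T.erase b := fun h => haT (Finset.mem_of_mem_erase h)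
      rw [singletonPairSum, Finset.mul_sum]
      refine Finset.sum_nbij' (fun x => (x.1, insert (b, a) x.2)) (fun x => (x.1, x.2.erase (b, a)))
        ?_ ?_ ?_ ?_ ?_
      · rintro ⟨S, Q⟩ h
        simp only [Finset.mem_filter, Finset.mem_univ, true_and] at h ⊢
        refine ⟨⟨?_, fun hS => haTb (h.mem_of_mem_left hS)⟩, Finset.mem_insert_self _ _⟩
        have := (IsSingletonPairPartition.insert_right_iff haTb (Finset.notMem_erase b T) (ha b hb)
          fun hQ => haTb (h.mem_of_mem_right hQ).2).2 h
        rwa [Finset.insert_erase hb] at this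
      · rintro ⟨S, Q⟩ h
        simp only [Finset.mem_filter, Finset.mem_univ, true_and] at h ⊢
        exact (h.1.1.erase_right haT h.2).2
      · rintro ⟨S, Q⟩ h
        simp only [Finset.mem_filter, Finset.mem_univ, true_and] at h ⊢
        rw [Finset.erase_insert fun hQ => haTb (h.mem_of_mem_right hQ).2]
      · rintro ⟨S, Q⟩ h
        simp only [Finset.mem_filter, Finset.mem_univ, true_and] at h ⊢
        rw [Finset.insert_erase h.2]
      · rintro ⟨S, Q⟩ h
        simp only [Finset.mem_filter, Finset.mem_univ, true_and] at h ⊢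
        rw [Finset.prod_insert fun hQ => haTb (h.mem_of_mem_right hQ).2]
        ring
    rw [Finset.sum_congr rfl hpair, Finset.filter_filter]
    simp only [← Finset.filter_filter _ fun x : Finset ι × Finset (ι × ι) => (_, a) ∈ x.2]
    simp only [Finset.sum_filter _ (s := Finset.filter _ _)]
    rw [Finset.sum_comm]
    refine Finset.sum_congr rfl fun x hx => ?_
    simp only [Finset.mem_filter, Finset.mem_univ, true_and] at hx
    obtain ⟨b, hb, huniq⟩ := hx.1.existsUnique_pair ha hx.2
    rw [Finset.sum_eq_single b (fun c _ hcb => if_neg fun hc => hcb (huniq c hc))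
      (fun hbT => absurd (hx.1.erase_right haT hb).1 hbT), if_pos hb]
end

/-- Isserlis' theorem for a finite subfamily of an affine Gaussian family. -/
lemma integral_prod_affine_eq_singletonPairSum {ι κ : Type*} [Fintype ι] [LinearOrder ι]
    [Fintype κ] (μ : ι → ℝ) (A : Matrix ι κ ℝ) (T : Finset ι) :
    ∫ ω, ∏ i ∈ T, (μ i + ∑ j, A i j * ω j) ∂(Measure.pi fun _ : κ => gaussianReal 0 1) =
      singletonPairSum μ (A * Aᵀ) T := by
  induction T using Finset.strongInduction with
  | H T ih =>
    rcases T.eq_empty_or_nonempty with rfl | hT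
    · simp [singletonPairSum_empty]
    · obtain ⟨a, U, haU, hlt, rfl⟩ : ∃ a U, a ∉ U ∧ (∀ x ∈ U, x < a) ∧ T = insert a U :=
        ⟨T.max' hT, T.erase (T.max' hT), Finset.notMem_erase _ _,
          fun _ => T.lt_max'_of_mem_erase_max' hT, (Finset.insert_erase (T.max'_mem hT)).symm⟩
      rw [integral_prod_affine_insert μ A haU, singletonPairSum_insert μ _ hlt,
        ih U (Finset.ssubset_insert haU)]
      congr 1
      exact Finset.sum_congr rfl fun b _ => congrArg _
        (ih _ ((Finset.erase_subset b U).trans_ssubset (Finset.ssubset_insert haU)))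

/-- **Isserlis' theorem for noncentral Gaussians.**  For jointly Gaussian
`Xᵢ = μᵢ + ∑ⱼ Aᵢⱼ ζⱼ` (with `ζ₁, …, ζₘ` i.i.d. standard Gaussian),
`E[X₁ ⋯ Xₙ] = ∑_{(S,P)} (∏_{s ∈ S} μ_s) (∏_{{i,j} ∈ P} Cov(Xᵢ, Xⱼ))`,
the sum ranging over all partitions of `{1, …, n}` into a set `S` of singletons
and a set `P` of unordered pairs (encoded as ordered pairs with `p.1 < p.2`:
the partition condition says that the multiset of elements of `S` together with all
members of the pairs in `P` is exactly `{1, …, n}`, each element appearing once),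
and `Cov(Xᵢ, Xⱼ) = (A Aᵀ)ᵢⱼ`. -/
theorem isserlis_noncentral
    (n m : ℕ) (μ : Fin n → ℝ) (A : Matrix (Fin n) (Fin m) ℝ)
    (P : Measure (Fin m → ℝ))
    (hP : P = Measure.pi fun _ => gaussianReal 0 1)
    (X : Fin n → (Fin m → ℝ) → ℝ)
    (hX : X = fun i ω => μ i + ∑ j, A i j * ω j) :
    ∫ ω, ∏ i, X i ω ∂P =
      ∑ S : Finset (Fin n), ∑ Pr : Finset (Fin n × Fin n),
        if (∀ p ∈ Pr, p.1 < p.2) ∧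
            S.val + Pr.val.bind (fun p => {p.1, p.2}) = (Finset.univ : Finset (Fin n)).val
        then (∏ s ∈ S, μ s) * ∏ p ∈ Pr, (A * Aᵀ) p.1 p.2
        else 0 := by
  classical
  subst hP hX
  rw [integral_prod_affine_eq_singletonPairSum, singletonPairSum, Finset.sum_filter,
    Fintype.sum_prod_type]
  refine Finset.sum_congr rfl fun S _ => Finset.sum_congr rfl fun Q _ => ?_
  exact if_congr Iff.rfl rfl rfl
end

section
/- Let X be a Gaussian random variable with mean μ and variance σ² > 0 (Stein's lemma). Let g : ℝ → ℝ be differentiable, and assume g'(X) is integrable and g(X)·(X − μ) is integrable. Then E[g(X)(X − μ)] = σ² E[g'(X)]; equivalently, Cov(g(X), X) = Var(X)·E[g'(X)]. -/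
open MeasureTheory ProbabilityTheory Real

open scoped NNReal

theorem hasDerivAt_gaussianPDFReal (μ : ℝ) {v : ℝ≥0} (hv : v ≠ 0) (x : ℝ) :
    HasDerivAt (gaussianPDFReal μ v) (-((x - μ) / v) * gaussianPDFReal μ v x) x := by
  have hv' : (v : ℝ) ≠ 0 := by exact_mod_cast hv
  have h : HasDerivAt (fun y : ℝ => -(y - μ) ^ 2 / (2 * v)) (-((x - μ) / v)) x := by
    have h' := ((((hasDerivAt_id x).sub_const μ).pow 2).neg).div_const (2 * (v : ℝ))
    refine h'.congr_deriv ?_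
    simp
    field_simp
  rw [gaussianPDFReal_def]
  refine (h.exp.const_mul _).congr_deriv ?_
  ring

theorem integrable_gaussianReal_iff (μ : ℝ) {v : ℝ≥0} (hv : v ≠ 0) (f : ℝ → ℝ) :
    Integrable f (gaussianReal μ v) ↔ Integrable (fun x => gaussianPDFReal μ v x * f x) := by
  rw [gaussianReal_of_var_ne_zero μ hv,
    integrable_withDensity_iff_integrable_smul' (measurable_gaussianPDF μ v)
      (Filter.Eventually.of_forall fun _ => gaussianPDF_lt_top)]
  simp [toReal_gaussianPDF]

/-- A continuous function is integrable on a ball around `c`, and `|f x| ≤ |f x * (x - c)|`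
outside the unit ball. -/
theorem Continuous.integrable_of_integrable_mul_sub {f : ℝ → ℝ} (hf : Continuous f) {c : ℝ}
    {m : Measure ℝ} [IsLocallyFiniteMeasure m]
    (h : Integrable (fun x => f x * (x - c)) m) : Integrable f m := by
  have hin : IntegrableOn f (Metric.closedBall c 1) m :=
    hf.continuousOn.integrableOn_compact (isCompact_closedBall c 1)
  have hout : IntegrableOn f (Metric.closedBall c 1)ᶜ m := by
    refine Integrable.mono h.integrableOn hf.aestronglyMeasurable ?_
    refine (ae_restrict_iff' Metric.isClosed_closedBall.measurableSet.compl).2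
      (Filter.Eventually.of_forall fun x hx => ?_)
    have hx' : 1 < ‖x - c‖ := by simpa [Real.dist_eq] using hx
    rw [norm_mul]
    exact le_mul_of_one_le_right (norm_nonneg _) hx'.le
  simpa using hin.union hout

theorem integral_mul_sub_gaussianReal (μ : ℝ) {v : ℝ≥0} (hv : v ≠ 0) {g : ℝ → ℝ}
    (hg : Differentiable ℝ g) (h1 : Integrable (fun x => deriv g x) (gaussianReal μ v))
    (h2 : Integrable (fun x => g x * (x - μ)) (gaussianReal μ v)) :
    ∫ x, g x * (x - μ) ∂(gaussianReal μ v) = v * ∫ x, deriv g x ∂(gaussianReal μ v) := by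
  have hv' : (v : ℝ) ≠ 0 := by exact_mod_cast hv
  have h0 := hg.continuous.integrable_of_integrable_mul_sub h2
  rw [integral_gaussianReal_eq_integral_smul hv, integral_gaussianReal_eq_integral_smul hv]
  rw [integrable_gaussianReal_iff μ hv] at h0 h1 h2
  have hderiv (x : ℝ) : HasDerivAt (fun x => gaussianPDFReal μ v x * g x)
      (gaussianPDFReal μ v x * deriv g x -
        (v : ℝ)⁻¹ * (gaussianPDFReal μ v x * (g x * (x - μ)))) x :=
    ((hasDerivAt_gaussianPDFReal μ hv x).mul (hg x).hasDerivAt).congr_deriv (by ring)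
  have hzero := integral_eq_zero_of_hasDerivAt_of_integrable hderiv
    (h1.sub (h2.const_mul (v : ℝ)⁻¹)) h0
  rw [integral_sub h1 (h2.const_mul _), integral_const_mul, sub_eq_zero] at hzero
  simp only [smul_eq_mul]
  rw [hzero, mul_inv_cancel_left₀ hv']

/-- **Stein's lemma.**  If `X ~ N(μ, σ²)` with `σ² > 0` and `g : ℝ → ℝ` is
differentiable with `g'(X)` and `g(X)·(X - μ)` integrable, then
`E[g(X)(X - μ)] = σ² E[g'(X)]`; equivalently,
`Cov(g(X), X) = Var(X) · E[g'(X)]`. -/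
theorem stein_lemma (μ σ : ℝ) (hσ : 0 < σ) (g : ℝ → ℝ)
    (hg : Differentiable ℝ g)
    (h1 : Integrable (fun x => deriv g x) (gaussianReal μ ⟨σ ^ 2, sq_nonneg σ⟩))
    (h2 : Integrable (fun x => g x * (x - μ)) (gaussianReal μ ⟨σ ^ 2, sq_nonneg σ⟩)) :
    ∫ x, g x * (x - μ) ∂(gaussianReal μ ⟨σ ^ 2, sq_nonneg σ⟩) =
      σ ^ 2 * ∫ x, deriv g x ∂(gaussianReal μ ⟨σ ^ 2, sq_nonneg σ⟩) := by
  have hv : (⟨σ ^ 2, sq_nonneg σ⟩ : ℝ≥0) ≠ 0 :=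
    fun h => (pow_pos hσ 2).ne' (congrArg NNReal.toReal h)
  exact integral_mul_sub_gaussianReal μ hv hg h1 h2
end

section
/- Let z be a standard Gaussian random vector in ℝ^d, and let f(z) = W_2 · ReLU(W_1 z + b_1) + b_2 be a single-hidden-layer ReLU MLP with W_1 ∈ ℝ^{h×d}, b_1 ∈ ℝ^h, W_2 ∈ ℝ^{m×h}, b_2 ∈ ℝ^m, where every row of W_1 is nonzero. Let s ∈ ℝ^h be the vector of Euclidean norms of the rows of W_1. Then E_z[f(z)] = W_2 · [ b_1 ⊙ Φ(b_1 ⊙ s^{-1}) + s ⊙ φ(b_1 ⊙ s^{-1}) ] + b_2, where ⊙ denotes elementwise multiplication, s^{-1} is the elementwise reciprocal, and φ, Φ are applied elementwise. -/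
open MeasureTheory ProbabilityTheory Real Matrix

/-- The standard normal density `φ(z) = exp(-z²/2)/√(2π)`. -/
noncomputable def stdNormalPDF (z : ℝ) : ℝ := Real.exp (-(z ^ 2) / 2) / Real.sqrt (2 * Real.pi)

/-- The standard normal CDF `Φ(x) = ∫_{-∞}^x φ(z) dz`. -/
noncomputable def stdNormalCDF (x : ℝ) : ℝ := ∫ z in Set.Iic x, stdNormalPDF z

lemma map_sum_mul_pi_gaussianReal {ι : Type*} [Fintype ι] (a : ι → ℝ) :
    (Measure.pi fun _ : ι => gaussianReal 0 1).map (fun z => ∑ i, a i * z i) =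
      (gaussianReal 0 1).map (√(∑ i, a i ^ 2) * ·) := by
  have hind : iIndepFun (fun i (z : ι → ℝ) => a i * z i)
      (Measure.pi fun _ : ι => gaussianReal 0 1) :=
    iIndepFun_pi (X := fun i x => a i * x) fun i => by fun_prop
  have hm (i : ι) : (Measure.pi fun _ : ι => gaussianReal 0 1).map (fun z => a i * z i) =
      (gaussianReal 0 1).map (a i * ·) := by
    conv_rhs => rw [← (measurePreserving_eval (fun _ : ι => gaussianReal 0 1) i).map_eq]
    rw [Measure.map_map (by fun_prop) (by fun_prop)]
    rfl
  have : IsProbabilityMeasure ((Measure.pi fun _ : ι => gaussianReal 0 1).map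
      (fun z => ∑ i, a i * z i)) :=
    Measure.isProbabilityMeasure_map (Measurable.aemeasurable (by fun_prop))
  have : IsProbabilityMeasure ((gaussianReal 0 1).map (√(∑ i, a i ^ 2) * ·)) :=
    Measure.isProbabilityMeasure_map (by fun_prop)
  refine Measure.ext_of_charFun (funext fun t => ?_)
  have h := congrFun (hind.charFun_map_sum_eq_prod fun i => Measurable.aemeasurable (by fun_prop)) t
  have hfun : (∑ i, fun z : ι → ℝ => a i * z i) = fun z => ∑ i, a i * z i := by
    ext z
    simp
  rw [hfun, Finset.prod_apply] at h
  have hs : ((√(∑ i, a i ^ 2) : ℝ) : ℂ) ^ 2 = ∑ i, (a i : ℂ) ^ 2 := by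
    rw [← Complex.ofReal_pow, Real.sq_sqrt (Finset.sum_nonneg fun i _ => sq_nonneg _)]
    simp
  rw [h]
  simp_rw [hm, charFun_map_mul, charFun_gaussianReal]
  rw [← Complex.exp_sum]
  congr 1
  simp [mul_pow, hs, Finset.sum_mul, Finset.sum_div]

lemma stdNormalPDF_eq_gaussianPDFReal : stdNormalPDF = gaussianPDFReal 0 1 := by
  ext x
  simp [stdNormalPDF, gaussianPDFReal, div_eq_inv_mul]

lemma stdNormalPDF_neg (x : ℝ) : stdNormalPDF (-x) = stdNormalPDF x := by
  simp [stdNormalPDF]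

lemma hasDerivAt_neg_stdNormalPDF (x : ℝ) :
    HasDerivAt (fun x => -stdNormalPDF x) (x * stdNormalPDF x) x := by
  have h : HasDerivAt (fun x : ℝ => -(x ^ 2) / 2) (-x) x :=
    ((hasDerivAt_pow 2 x).neg.div_const 2).congr_deriv (by push_cast; ring)
  refine (h.exp.div_const √(2 * Real.pi)).neg.congr_deriv ?_
  rw [stdNormalPDF]
  ring

lemma integrable_stdNormalPDF : Integrable stdNormalPDF := by
  rw [stdNormalPDF_eq_gaussianPDFReal]
  exact integrable_gaussianPDFReal 0 1

lemma integrable_mul_stdNormalPDF : Integrable fun x => x * stdNormalPDF x := by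
  refine ((integrable_mul_exp_neg_mul_sq (b := 1 / 2) (by norm_num)).div_const
    √(2 * Real.pi)).congr (ae_of_all _ fun x => ?_)
  simp only [stdNormalPDF]
  rw [mul_div_assoc]
  ring_nf

lemma tendsto_stdNormalPDF_atTop : Filter.Tendsto stdNormalPDF Filter.atTop (nhds 0) := by
  have h : Filter.Tendsto (fun x : ℝ => -(x ^ 2) / 2) Filter.atTop Filter.atBot := by
    simp_rw [neg_div]
    exact Filter.tendsto_neg_atTop_atBot.comp
      ((Filter.tendsto_pow_atTop two_ne_zero).atTop_div_const two_pos)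
  rw [← zero_div √(2 * Real.pi)]
  exact (Real.tendsto_exp_atBot.comp h).div_const √(2 * Real.pi)

lemma integral_Ioi_neg_stdNormalPDF (c : ℝ) :
    ∫ x in Set.Ioi (-c), stdNormalPDF x = stdNormalCDF c := by
  rw [← integral_comp_neg_Iic]
  simp_rw [stdNormalPDF_neg]
  rfl

lemma integral_Ioi_neg_mul_stdNormalPDF (c : ℝ) :
    ∫ x in Set.Ioi (-c), x * stdNormalPDF x = stdNormalPDF c := by
  rw [integral_Ioi_of_hasDerivAt_of_tendsto' (fun x _ => hasDerivAt_neg_stdNormalPDF x)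
    integrable_mul_stdNormalPDF.integrableOn tendsto_stdNormalPDF_atTop.neg]
  simp [stdNormalPDF_neg]

lemma integral_relu_affine_gaussianReal {s : ℝ} (hs : 0 < s) (b : ℝ) :
    ∫ x, max (s * x + b) 0 ∂(gaussianReal 0 1) =
      b * stdNormalCDF (b * s⁻¹) + s * stdNormalPDF (b * s⁻¹) := by
  have hind : (fun x => stdNormalPDF x • max (s * x + b) 0) =
      (Set.Ioi (-(b * s⁻¹))).indicator
        fun x => b * stdNormalPDF x + s * (x * stdNormalPDF x) := by
    ext x
    have hx : s * x + b = s * (x + b * s⁻¹) := by field_simp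
    by_cases h : -(b * s⁻¹) < x
    · rw [Set.indicator_of_mem (Set.mem_Ioi.2 h), max_eq_left, smul_eq_mul]
      · ring
      · rw [hx]
        exact mul_nonneg hs.le (by linarith)
    · rw [Set.indicator_of_notMem (by simpa using h), max_eq_right, smul_zero]
      rw [hx]
      exact mul_nonpos_of_nonneg_of_nonpos hs.le (by linarith)
  rw [integral_gaussianReal_eq_integral_smul one_ne_zero, ← stdNormalPDF_eq_gaussianPDFReal, hind,
    integral_indicator measurableSet_Ioi,
    integral_add (integrable_stdNormalPDF.const_mul b).integrableOn
      (integrable_mul_stdNormalPDF.const_mul s).integrableOn,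
    integral_const_mul, integral_const_mul, integral_Ioi_neg_stdNormalPDF,
    integral_Ioi_neg_mul_stdNormalPDF]

lemma integrable_relu_affine_pi_gaussianReal {ι : Type*} [Fintype ι] (a : ι → ℝ) (b : ℝ) :
    Integrable (fun z => max (∑ i, a i * z i + b) 0)
      (Measure.pi fun _ : ι => gaussianReal 0 1) := by
  have hid : Integrable (fun x : ℝ => x) (gaussianReal 0 1) :=
    (memLp_id_gaussianReal 1).integrable le_rfl
  exact ((integrable_finsetSum _ fun i _ =>
    (integrable_comp_eval (μ := fun _ : ι => gaussianReal 0 1) (i := i) hid).const_mul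
      (a i)).add (integrable_const b)).pos_part

lemma integral_relu_affine_pi_gaussianReal {ι : Type*} [Fintype ι] {a : ι → ℝ} (ha : a ≠ 0)
    (b : ℝ) :
    ∫ z, max (∑ i, a i * z i + b) 0 ∂(Measure.pi fun _ : ι => gaussianReal 0 1) =
      b * stdNormalCDF (b * (√(∑ i, a i ^ 2))⁻¹) +
        √(∑ i, a i ^ 2) * stdNormalPDF (b * (√(∑ i, a i ^ 2))⁻¹) := by
  have hs : 0 < √(∑ i, a i ^ 2) := by
    obtain ⟨i, hi⟩ := Function.ne_iff.1 ha
    exact Real.sqrt_pos.2 (Finset.sum_pos' (fun _ _ => sq_nonneg _)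
      ⟨i, Finset.mem_univ i, sq_pos_of_ne_zero (by simpa using hi)⟩)
  rw [← integral_relu_affine_gaussianReal hs,
    ← integral_map (φ := fun z : ι → ℝ => ∑ i, a i * z i) (f := fun x => max (x + b) 0)
      (Measurable.aemeasurable (by fun_prop)) (by fun_prop),
    map_sum_mul_pi_gaussianReal, integral_map (by fun_prop) (by fun_prop)]

/-- Closed form for the Gaussian mean of a single-hidden-layer ReLU MLP
`f(z) = W₂ · ReLU(W₁ z + b₁) + b₂` with every row of `W₁` nonzero:
`E[f(z)] = W₂ · (b₁ ⊙ Φ(b₁ ⊙ s⁻¹) + s ⊙ φ(b₁ ⊙ s⁻¹)) + b₂`, where `s` is the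
vector of Euclidean norms of the rows of `W₁`, `⊙` is elementwise multiplication,
and `φ, Φ` are applied elementwise. -/
theorem relu_mlp_mean (d h m : ℕ)
    (W1 : Matrix (Fin h) (Fin d) ℝ) (b1 : Fin h → ℝ)
    (W2 : Matrix (Fin m) (Fin h) ℝ) (b2 : Fin m → ℝ)
    (hW1 : ∀ i, W1 i ≠ 0)
    (s : Fin h → ℝ) (hs : s = fun i => Real.sqrt (∑ j, (W1 i j) ^ 2))
    (f : (Fin d → ℝ) → Fin m → ℝ)
    (hf : f = fun z => W2.mulVec (fun i => max ((W1.mulVec z + b1) i) 0) + b2) :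
    (fun j => ∫ z, f z j ∂(Measure.pi fun _ : Fin d => gaussianReal 0 1)) =
      W2.mulVec
          (fun i => b1 i * stdNormalCDF (b1 i * (s i)⁻¹)
            + s i * stdNormalPDF (b1 i * (s i)⁻¹))
        + b2 := by
  subst hs hf
  ext j
  calc
    _ = ∫ z : Fin d → ℝ, (∑ i, W2 j i * max (∑ k, W1 i k * z k + b1 i) 0 + b2 j)
          ∂(Measure.pi fun _ => gaussianReal 0 1) := rfl
    _ = ∑ i, W2 j i * ∫ z : Fin d → ℝ, max (∑ k, W1 i k * z k + b1 i) 0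
          ∂(Measure.pi fun _ => gaussianReal 0 1) + b2 j := by
      have hint (i : Fin h) := (integrable_relu_affine_pi_gaussianReal (W1 i) (b1 i)).const_mul
        (W2 j i)
      rw [integral_add (integrable_finsetSum _ fun i _ => hint i) (integrable_const _),
        integral_finsetSum _ fun i _ => hint i]
      simp [integral_const_mul]
    _ = _ := by
      simp_rw [fun i => integral_relu_affine_pi_gaussianReal (hW1 i) (b1 i)]
      rfl
end
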